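/- (Converse step of Theorem 1) Let (φ_n = (τ_n, Z_n))_n be any sequence of sequential tests with finite expected stopping times that are unbounded in n. Let 𝒜'_n be the adversary strategy that fixes the i.i.d. choices p̂_i ≡ p₀* under H₀ and q̂_i ≡ q₀* under H₁. If the type-I errors satisfy π_{1|0}(φ_n,𝒜'_n) → 0 as n → ∞, then liminf_{n→∞} (−log π_{0|1}(φ_n,𝒜'_n)) / E_ℙ[τ_n] ≤ D(p₀*‖q₀*). -/

import Mathlib

open scoped BigOperators ENNReal

variable {𝒳 : Type*}

/-- A probability mass function on the finite alphabet `𝒳`. -/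
def IsDist [Fintype 𝒳] (f : 𝒳 → ℝ) : Prop :=
  (∀ x, 0 ≤ f x) ∧ ∑ x, f x = 1

/-- Kullback–Leibler divergence `D(p‖q) = ∑ₓ p(x) log (p(x)/q(x))`. -/
noncomputable def KL [Fintype 𝒳] (p q : 𝒳 → ℝ) : ℝ :=
  ∑ x, p x * Real.log (p x / q x)

/-- Probability of observing the finite sequence `l` under the adaptive strategy `str`:
`ℙ(x^t) = ∏ᵢ str(x^{i-1})(xᵢ)`. -/
noncomputable def seqProb [Fintype 𝒳] (str : List 𝒳 → 𝒳 → ℝ) (l : List 𝒳) : ℝ :=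
  ∏ i : Fin l.length, str (l.take i.1) (l.get i)

/-- Log-likelihood-ratio sum `S_t = ∑ᵢ log (p(xᵢ)/q(xᵢ))`. -/
noncomputable def llSum (p q : 𝒳 → ℝ) (l : List 𝒳) : ℝ :=
  ∑ i : Fin l.length, Real.log (p (l.get i) / q (l.get i))

/-- An adaptive adversary strategy choosing, after each history, a distribution in `P`. -/
def IsStrategy (P : Set (𝒳 → ℝ)) (str : List 𝒳 → 𝒳 → ℝ) : Prop :=
  ∀ l, str l ∈ P

open Classical in
/-- Probability that the first `n` observations form a sequence satisfying `E`. -/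
noncomputable def probAt [Fintype 𝒳] (str : List 𝒳 → 𝒳 → ℝ) (n : ℕ)
    (E : List 𝒳 → Prop) : ℝ :=
  ∑ x : Fin n → 𝒳, if E (List.ofFn x) then seqProb str (List.ofFn x) else 0

/-- No prefix of `l` (including `l` itself) lies in the stopping region `B`;
for `l` of length `n` this is the event `{τ_B > n}`. -/
def notYet (B : List 𝒳 → Prop) (l : List 𝒳) : Prop :=
  ∀ t ≤ l.length, ¬ B (l.take t)

/-- `l` is a stopped sequence of the first-hitting time `τ_B` of the region `B`. -/
def stopsAt (B : List 𝒳 → Prop) (l : List 𝒳) : Prop :=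
  B l ∧ ∀ t < l.length, ¬ B (l.take t)

/-- Expected stopping time `E[τ_B] = ∑_{n ≥ 0} ℙ(τ_B > n)`, valued in `ℝ≥0∞`. -/
noncomputable def expTau [Fintype 𝒳] (str : List 𝒳 → 𝒳 → ℝ) (B : List 𝒳 → Prop) : ℝ≥0∞ :=
  ∑' n : ℕ, ENNReal.ofReal (probAt str n (notYet B))

open Classical in
/-- Expectation of `f` evaluated at the stopped sequence `X^{τ_B}`. -/
noncomputable def expStopped [Fintype 𝒳] (str : List 𝒳 → 𝒳 → ℝ) (B : List 𝒳 → Prop)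
    (f : List 𝒳 → ℝ) : ℝ :=
  ∑' l : List 𝒳, if stopsAt B l then seqProb str l * f l else 0

open Classical in
/-- Probability that the process stops (via `B`) at a sequence satisfying `E`. -/
noncomputable def probStopIn [Fintype 𝒳] (str : List 𝒳 → 𝒳 → ℝ) (B : List 𝒳 → Prop)
    (E : List 𝒳 → Prop) : ℝ :=
  ∑' l : List 𝒳, if stopsAt B l ∧ E l then seqProb str l else 0

open Classical in
/-- Probability, under the law induced by strategy `str`, that the test with stopping
region `B` and decision rule `Z` stops and outputs the decision `b`
(`b = true` codes the decision `1`, `b = false` the decision `0`). -/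
noncomputable def errProb [Fintype 𝒳] (str : List 𝒳 → 𝒳 → ℝ) (B : List 𝒳 → Prop)
    (Z : List 𝒳 → Bool) (b : Bool) : ℝ :=
  ∑' l : List 𝒳, if stopsAt B l ∧ Z l = b then seqProb str l else 0

/-- Worst-case (over adaptive adversary strategies with values in `P`) probability of
outputting the decision `b`. -/
noncomputable def worstErr [Fintype 𝒳] (P : Set (𝒳 → ℝ)) (B : List 𝒳 → Prop)
    (Z : List 𝒳 → Bool) (b : Bool) : ℝ :=
  ⨆ str : {s : List 𝒳 → 𝒳 → ℝ // IsStrategy P s}, errProb str.1 B Z b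

/-- Worst-case (over adaptive adversary strategies with values in `P`) expected
stopping time. -/
noncomputable def worstExpTau [Fintype 𝒳] (P : Set (𝒳 → ℝ)) (B : List 𝒳 → Prop) : ℝ≥0∞ :=
  ⨆ str : {s : List 𝒳 → 𝒳 → ℝ // IsStrategy P s}, expTau str.1 B

/-- The stopping region (or any family indexed by histories) seen after the first letter `a`. -/
def afterFirst {α : Type*} (f : List 𝒳 → α) (a : 𝒳) : List 𝒳 → α :=
  fun l => f (a :: l)

open Classical in
/-- Expectation of `f (X^{τ_B ∧ N})` when the letters are i.i.d. with law `p`. -/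
noncomputable def truncMean [Fintype 𝒳] (p : 𝒳 → ℝ) :
    ℕ → (List 𝒳 → Prop) → (List 𝒳 → ℝ) → ℝ
  | 0, _, f => f []
  | N + 1, B, f =>
    if B [] then f [] else ∑ a, p a * truncMean p N (afterFirst B a) (afterFirst f a)

open Classical in
/-- The finite set of words of length at most `N`. -/
noncomputable def wordsUpTo [Fintype 𝒳] : ℕ → Finset (List 𝒳)
  | 0 => {[]}
  | N + 1 => insert []
      ((Finset.univ ×ˢ wordsUpTo N).image fun x : 𝒳 × List 𝒳 => x.1 :: x.2)

theorem notYet_nil (B : List 𝒳 → Prop) : notYet B [] ↔ ¬ B [] := by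
  simp [notYet]

theorem notYet_cons (B : List 𝒳 → Prop) (a : 𝒳) (l : List 𝒳) :
    notYet B (a :: l) ↔ ¬ B [] ∧ notYet (afterFirst B a) l := by
  constructor
  · intro h
    refine ⟨by simpa using h 0 (Nat.zero_le _), fun t ht => ?_⟩
    simpa [afterFirst] using h (t + 1) (by simpa using ht)
  · rintro ⟨h0, h⟩ t ht
    cases t with
    | zero => simpa using h0
    | succ t => simpa [afterFirst] using h t (by simpa using ht)

theorem stopsAt_nil (B : List 𝒳 → Prop) : stopsAt B [] ↔ B [] := by
  simp [stopsAt]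

theorem stopsAt_cons (B : List 𝒳 → Prop) (a : 𝒳) (l : List 𝒳) :
    stopsAt B (a :: l) ↔ ¬ B [] ∧ stopsAt (afterFirst B a) l := by
  constructor
  · rintro ⟨h1, h⟩
    refine ⟨by simpa using h 0 (by simp), h1, fun t ht => ?_⟩
    simpa [afterFirst] using h (t + 1) (by simpa using ht)
  · rintro ⟨h0, h1, h⟩
    refine ⟨h1, fun t ht => ?_⟩
    cases t with
    | zero => simpa using h0
    | succ t => simpa [afterFirst] using h t (by simpa using ht)

section
variable [Fintype 𝒳]

theorem mem_wordsUpTo (l : List 𝒳) : ∀ N, l.length ≤ N → l ∈ wordsUpTo N := by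
  induction l with
  | nil => intro N _; cases N <;> simp [wordsUpTo]
  | cons a l ih =>
    intro N hN
    cases N with
    | zero => simp at hN
    | succ N =>
      have := ih N (by simpa using hN)
      simpa [wordsUpTo] using this

theorem sum_wordsUpTo_succ (N : ℕ) (f : List 𝒳 → ℝ) :
    ∑ l ∈ wordsUpTo (N + 1), f l = f [] + ∑ a, ∑ l ∈ wordsUpTo N, f (a :: l) := by
  classical
  rw [wordsUpTo, Finset.sum_insert (by simp), Finset.sum_image, Finset.sum_product]
  rintro ⟨a, l⟩ _ ⟨b, m⟩ _ h
  simpa using h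

theorem seqProb_nil (p : 𝒳 → ℝ) : seqProb (fun _ => p) [] = 1 := by
  simp [seqProb]

theorem seqProb_cons (p : 𝒳 → ℝ) (a : 𝒳) (l : List 𝒳) :
    seqProb (fun _ => p) (a :: l) = p a * seqProb (fun _ => p) l := by
  simp only [seqProb]
  exact Fin.prod_univ_succ (n := l.length) fun i => p ((a :: l).get i)

theorem seqProb_nonneg {p : 𝒳 → ℝ} (hp : ∀ x, 0 ≤ p x) (l : List 𝒳) :
    0 ≤ seqProb (fun _ => p) l :=
  Finset.prod_nonneg fun _ _ => hp _

open Classical in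
theorem probAt_notYet_zero (p : 𝒳 → ℝ) (B : List 𝒳 → Prop) :
    probAt (fun _ => p) 0 (notYet B) = if B [] then 0 else 1 := by
  by_cases h : B [] <;> simp [probAt, notYet_nil, seqProb_nil, h]

open Classical in
theorem probAt_notYet_succ (p : 𝒳 → ℝ) (B : List 𝒳 → Prop) (n : ℕ) :
    probAt (fun _ => p) (n + 1) (notYet B) =
      if B [] then 0 else ∑ a, p a * probAt (fun _ => p) n (notYet (afterFirst B a)) := by
  unfold probAt
  rw [← (Fin.consEquiv fun _ : Fin (n + 1) => 𝒳).sum_comp, Fintype.sum_prod_type]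
  by_cases h : B [] <;>
    simp [Fin.consEquiv, notYet_cons, seqProb_cons, h, Finset.mul_sum]

theorem probAt_nonneg {p : 𝒳 → ℝ} (hp : ∀ x, 0 ≤ p x) (n : ℕ) (E : List 𝒳 → Prop) :
    0 ≤ probAt (fun _ => p) n E := by
  refine Finset.sum_nonneg fun x _ => ?_
  split_ifs
  exacts [seqProb_nonneg hp _, le_rfl]

open Classical in
theorem sum_range_probAt_succ {p : 𝒳 → ℝ} (B : List 𝒳 → Prop) (N : ℕ) :
    ∑ n ∈ Finset.range (N + 1), probAt (fun _ => p) n (notYet B) =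
      if B [] then 0 else
        1 + ∑ a, p a *
          ∑ n ∈ Finset.range N, probAt (fun _ => p) n (notYet (afterFirst B a)) := by
  rw [Finset.sum_range_succ']
  by_cases h : B []
  · simp [probAt_notYet_zero, probAt_notYet_succ, h]
  · simp only [probAt_notYet_zero, probAt_notYet_succ, h, if_false, Finset.mul_sum]
    rw [Finset.sum_comm, add_comm]

theorem truncMean_mono {p : 𝒳 → ℝ} (hp : ∀ x, 0 ≤ p x) (N : ℕ) :
    ∀ (B : List 𝒳 → Prop) (f g : List 𝒳 → ℝ), (∀ l, f l ≤ g l) →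
      truncMean p N B f ≤ truncMean p N B g := by
  induction N with
  | zero => intro B f g h; exact h []
  | succ N ih =>
    intro B f g h
    rw [truncMean, truncMean]
    split_ifs
    · exact h []
    · exact Finset.sum_le_sum fun a _ =>
        mul_le_mul_of_nonneg_left (ih _ _ _ fun l => h _) (hp a)

theorem truncMean_add (p : 𝒳 → ℝ) (N : ℕ) :
    ∀ (B : List 𝒳 → Prop) (f g : List 𝒳 → ℝ),
      truncMean p N B (fun l => f l + g l) = truncMean p N B f + truncMean p N B g := by
  induction N with
  | zero => intro B f g; rfl
  | succ N ih =>
    intro B f g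
    simp only [truncMean]
    split_ifs
    · rfl
    · rw [← Finset.sum_add_distrib]
      exact Finset.sum_congr rfl fun a _ => by
        rw [← mul_add, ← ih]
        rfl

theorem truncMean_const_mul (p : 𝒳 → ℝ) (c : ℝ) (N : ℕ) :
    ∀ (B : List 𝒳 → Prop) (f : List 𝒳 → ℝ),
      truncMean p N B (fun l => c * f l) = c * truncMean p N B f := by
  induction N with
  | zero => intro B f; rfl
  | succ N ih =>
    intro B f
    simp only [truncMean]
    split_ifs
    · rfl
    · rw [Finset.mul_sum]
      exact Finset.sum_congr rfl fun a _ => by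
        rw [mul_left_comm, ← ih]
        rfl

theorem truncMean_one {p : 𝒳 → ℝ} (hp : IsDist p) (N : ℕ) :
    ∀ B : List 𝒳 → Prop, truncMean p N B (fun _ => 1) = 1 := by
  induction N with
  | zero => intro B; rfl
  | succ N ih =>
    intro B
    rw [truncMean]
    split_ifs
    · rfl
    · exact (Finset.sum_congr rfl fun a _ =>
        (congrArg (p a * ·) (ih (afterFirst B a))).trans (mul_one _)).trans hp.2

open Classical in
theorem truncMean_not_stopped (p : 𝒳 → ℝ) (N : ℕ) :
    ∀ B : List 𝒳 → Prop,
      truncMean p N B (fun l => if B l then 0 else 1) = probAt (fun _ => p) N (notYet B) := by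
  induction N with
  | zero => intro B; rw [probAt_notYet_zero]; rfl
  | succ N ih =>
    intro B
    rw [truncMean, probAt_notYet_succ]
    by_cases h : B []
    · simp [h]
    · rw [if_neg h, if_neg h]
      exact Finset.sum_congr rfl fun a _ => congrArg (p a * ·) (ih (afterFirst B a))

open Classical in
theorem truncMean_decision (p : 𝒳 → ℝ) (b : Bool) (N : ℕ) :
    ∀ (B : List 𝒳 → Prop) (Z : List 𝒳 → Bool),
      truncMean p N B (fun l => if B l ∧ Z l = b then 1 else 0) =
        ∑ l ∈ wordsUpTo N, if stopsAt B l ∧ Z l = b then seqProb (fun _ => p) l else 0 := by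
  induction N with
  | zero => intro B Z; simp [truncMean, wordsUpTo, stopsAt_nil, seqProb_nil]
  | succ N ih =>
    intro B Z
    rw [truncMean, sum_wordsUpTo_succ]
    by_cases h : B []
    · simp [h, stopsAt_nil, stopsAt_cons, seqProb_nil]
    · simp only [h, if_false, stopsAt_nil, stopsAt_cons, seqProb_cons, false_and, not_false_eq_true,
        true_and, zero_add]
      refine Finset.sum_congr rfl fun a _ => ?_
      have := ih (afterFirst B a) (afterFirst Z a)
      refine (congrArg (p a * ·) this).trans ?_
      simp only [Finset.mul_sum, mul_ite, mul_zero]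
      rfl

open Classical in
theorem truncMean_decision_le_errProb {p : 𝒳 → ℝ} (hp : IsDist p) (N : ℕ)
    (B : List 𝒳 → Prop) (Z : List 𝒳 → Bool) (b : Bool) :
    truncMean p N B (fun l => if B l ∧ Z l = b then 1 else 0) ≤
      errProb (fun _ => p) B Z b := by
  have hnn : ∀ l, 0 ≤ if stopsAt B l ∧ Z l = b then seqProb (fun _ => p) l else 0 := by
    intro l
    split_ifs
    exacts [seqProb_nonneg hp.1 l, le_rfl]
  have hsum : Summable
      fun l => if stopsAt B l ∧ Z l = b then seqProb (fun _ => p) l else 0 := by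
    refine summable_of_sum_le (c := 1) hnn fun s => ?_
    refine (Finset.sum_le_sum_of_subset_of_nonneg (t := wordsUpTo (s.sup List.length))
      (fun l hl => mem_wordsUpTo l _ (Finset.le_sup hl)) fun l _ _ => hnn l).trans ?_
    rw [← truncMean_decision p b]
    refine (truncMean_mono hp.1 _ _ _ (fun _ => 1) fun l => ?_).trans (truncMean_one hp _ B).le
    split_ifs <;> norm_num
  rw [truncMean_decision, errProb]
  exact hsum.sum_le_tsum _ fun l _ => hnn l

/-- A variational (Donsker–Varadhan type) bound at the truncated stopping time `τ_B ∧ N`. -/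
theorem truncMean_le_KL_mul {p q : 𝒳 → ℝ} (hp : IsDist p) (hq : IsDist q)
    (hpq : ∀ x, p x = 0 ↔ q x = 0) (N : ℕ) :
    ∀ (B : List 𝒳 → Prop) (f : List 𝒳 → ℝ) (c : ℝ), 0 < c →
      truncMean p N B f ≤
        KL p q * ∑ n ∈ Finset.range N, probAt (fun _ => p) n (notYet B) +
          truncMean q N B (fun l => Real.exp (f l)) / c + Real.log c - 1 := by
  have base : ∀ y c : ℝ, 0 < c → y ≤ Real.exp y / c + Real.log c - 1 := by
    intro y c hc
    have := Real.add_one_le_exp (y - Real.log c)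
    rw [Real.exp_sub, Real.exp_log hc] at this
    linarith
  induction N with
  | zero => intro B f c hc; simpa [truncMean] using base (f []) c hc
  | succ N ih =>
    intro B f c hc
    rw [truncMean, truncMean, sum_range_probAt_succ]
    by_cases h : B []
    · simpa [h] using base (f []) c hc
    rw [if_neg h, if_neg h, if_neg h]
    set T : 𝒳 → ℝ := fun a =>
      ∑ n ∈ Finset.range N, probAt (fun _ => p) n (notYet (afterFirst B a)) with hT
    set G : 𝒳 → ℝ := fun a =>
      truncMean q N (afterFirst B a) (afterFirst (fun l => Real.exp (f l)) a) with hG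
    have key : ∀ a, p a * truncMean p N (afterFirst B a) (afterFirst f a) ≤
        KL p q * (p a * T a) + q a * G a / c + p a * Real.log c
          + p a * Real.log (p a / q a) - p a := by
      intro a
      by_cases ha : p a = 0
      · simp [ha, (hpq a).1 ha]
      have hpa : 0 < p a := lt_of_le_of_ne (hp.1 a) (Ne.symm ha)
      have hqa : 0 < q a := lt_of_le_of_ne (hq.1 a) fun h => ha ((hpq a).2 h.symm)
      have := mul_le_mul_of_nonneg_left
        (ih (afterFirst B a) (afterFirst f a) (c * (p a / q a)) (by positivity)) hpa.le
      refine this.trans (le_of_eq ?_)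
      rw [Real.log_mul hc.ne' (by positivity)]
      change p a * (KL p q * T a + G a / (c * (p a / q a)) + _ - 1) = _
      field_simp
      ring
    refine (Finset.sum_le_sum fun a _ => key a).trans (le_of_eq ?_)
    simp only [Finset.sum_sub_distrib, Finset.sum_add_distrib, ← Finset.mul_sum,
      ← Finset.sum_mul, ← Finset.sum_div, hp.2]
    rw [← KL]
    ring

theorem KL_nonneg {p q : 𝒳 → ℝ} (hp : IsDist p) (hq : IsDist q)
    (hpq : ∀ x, p x = 0 ↔ q x = 0) : 0 ≤ KL p q := by
  have h := truncMean_le_KL_mul hp hq hpq 1 (fun _ => False) (fun _ => 0) 1 one_pos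
  have h1 := truncMean_one hq 1 fun _ => False
  simpa [truncMean, afterFirst, probAt_notYet_zero, hq.2] using h

theorem sum_range_probAt_le_expTau {p : 𝒳 → ℝ} (hp : ∀ x, 0 ≤ p x) {B : List 𝒳 → Prop}
    (hfin : expTau (fun _ => p) B ≠ ⊤) (N : ℕ) :
    ∑ n ∈ Finset.range N, probAt (fun _ => p) n (notYet B) ≤
      (expTau (fun _ => p) B).toReal := by
  rw [← ENNReal.ofReal_le_iff_le_toReal hfin,
    ENNReal.ofReal_sum_of_nonneg fun n _ => probAt_nonneg hp n _]
  exact ENNReal.sum_le_tsum _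

theorem tendsto_probAt_notYet {p : 𝒳 → ℝ} (hp : ∀ x, 0 ≤ p x) {B : List 𝒳 → Prop}
    (hfin : expTau (fun _ => p) B ≠ ⊤) :
    Filter.Tendsto (fun n => probAt (fun _ => p) n (notYet B)) Filter.atTop (nhds 0) :=
  (summable_of_sum_range_le (fun n => probAt_nonneg hp n _)
    (sum_range_probAt_le_expTau hp hfin)).tendsto_atTop_zero

/-- Non-asymptotic converse: trade-off between the error probabilities and the expected
stopping time of a sequential test between two i.i.d. laws. -/
theorem neg_log_errProb_mul_le {p q : 𝒳 → ℝ} (hp : IsDist p) (hq : IsDist q)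
    (hpq : ∀ x, p x = 0 ↔ q x = 0) {B : List 𝒳 → Prop} (Z : List 𝒳 → Bool)
    (hfin : expTau (fun _ => p) B ≠ ⊤)
    (hlog : 0 < -Real.log (errProb (fun _ => q) B Z false)) :
    -Real.log (errProb (fun _ => q) B Z false) * (1 - errProb (fun _ => p) B Z true) ≤
      KL p q * (expTau (fun _ => p) B).toReal + 1 := by
  classical
  set β := errProb (fun _ => q) B Z false with hβ
  set α := errProb (fun _ => p) B Z true with hα
  set L := -Real.log β with hL
  have hβ0 : 0 < β := by
    refine lt_of_le_of_ne (tsum_nonneg fun l => ?_) fun h => ?_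
    · split_ifs
      exacts [seqProb_nonneg hq.1 l, le_rfl]
    · rw [hL, ← h] at hlog
      simp at hlog
  have hexp : Real.exp L * β = 1 := by
    rw [hL, Real.exp_neg, Real.exp_log hβ0, inv_mul_cancel₀ hβ0.ne']
  have bound : ∀ N, L * (1 - α - probAt (fun _ => p) N (notYet B)) ≤
      KL p q * (expTau (fun _ => p) B).toReal + 1 := by
    intro N
    set A : List 𝒳 → ℝ := fun l => if B l ∧ Z l = false then 1 else 0 with hA
    have h := truncMean_le_KL_mul hp hq hpq N B (fun l => L * A l) 1 one_pos
    rw [truncMean_const_mul, Real.log_one, div_one] at h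
    have h1 : truncMean q N B (fun l => Real.exp (L * A l)) ≤ 2 := by
      calc truncMean q N B (fun l => Real.exp (L * A l))
          ≤ truncMean q N B (fun l => 1 + Real.exp L * A l) := by
            refine truncMean_mono hq.1 _ _ _ _ fun l => ?_
            by_cases hl : B l ∧ Z l = false <;> simp [hA, hl]
        _ = 1 + Real.exp L * truncMean q N B A := by
            rw [truncMean_add q N B (fun _ => 1), truncMean_one hq, truncMean_const_mul]
        _ ≤ 1 + Real.exp L * β := by
            gcongr
            exact truncMean_decision_le_errProb hq N B Z false
        _ = 2 := by rw [hexp]; norm_num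
    have h2 : 1 ≤ truncMean p N B A + (α + probAt (fun _ => p) N (notYet B)) := by
      calc (1 : ℝ) = truncMean p N B (fun l => A l +
            ((if B l ∧ Z l = true then 1 else 0) + if B l then 0 else 1)) := by
            refine (truncMean_one hp N B).symm.trans (congrArg (truncMean p N B) ?_)
            funext l
            by_cases hB : B l <;> cases hZ : Z l <;> simp [hA, hB, hZ]
        _ = truncMean p N B A + (truncMean p N B (fun l => if B l ∧ Z l = true then 1 else 0)
              + probAt (fun _ => p) N (notYet B)) := by
            rw [truncMean_add, truncMean_add, truncMean_not_stopped]
        _ ≤ _ := by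
            gcongr
            exact truncMean_decision_le_errProb hp N B Z true
    have h3 := mul_le_mul_of_nonneg_left (sum_range_probAt_le_expTau hp.1 hfin N)
      (KL_nonneg hp hq hpq)
    have h4 : L * (1 - α - probAt (fun _ => p) N (notYet B)) ≤ L * truncMean p N B A :=
      mul_le_mul_of_nonneg_left (by linarith) hlog.le
    linarith
  have hlim := ((tendsto_probAt_notYet hp.1 hfin).const_sub (1 - α)).const_mul L
  rw [sub_zero] at hlim
  exact le_of_tendsto' hlim bound

end

/-- **converse step of Theorem 1.** Let `(φ_n = (τ_n, Z_n))_n` be any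
sequence of sequential tests with finite expected stopping times that are unbounded in `n`,
and let `𝒜'_n` be the adversary fixing the i.i.d. choices `p₀*` under `H₀` and `q₀*` under
`H₁`.  If `π_{1|0}(φ_n, 𝒜'_n) → 0`, then
`liminf_n (−log π_{0|1}(φ_n, 𝒜'_n)) / E_ℙ[τ_n] ≤ D(p₀*‖q₀*)`. -/
theorem stmt13 [Fintype 𝒳] [Nonempty 𝒳]
    (P Q : Set (𝒳 → ℝ))
    (hP : ∀ p ∈ P, IsDist p) (hQ : ∀ q ∈ Q, IsDist q)
    (hPclosed : IsClosed P) (hQclosed : IsClosed Q)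
    (hPconv : Convex ℝ P) (hQconv : Convex ℝ Q)
    (hdisj : Disjoint P Q)
    (hac : ∀ p ∈ P, ∀ q ∈ Q, ∀ x, (p x = 0 ↔ q x = 0))
    (p₀ q₀ : 𝒳 → ℝ) (hp₀ : p₀ ∈ P) (hq₀ : q₀ ∈ Q)
    (hmin₀ : ∀ p ∈ P, ∀ q ∈ Q, KL p₀ q₀ ≤ KL p q)
    (B : ℕ → List 𝒳 → Prop) (Z : ℕ → List 𝒳 → Bool)
    (hfinP : ∀ n, expTau (fun _ => p₀) (B n) ≠ ⊤)
    (hfinQ : ∀ n, expTau (fun _ => q₀) (B n) ≠ ⊤)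
    (hunbP : ∀ C : ℝ, ∃ n, C ≤ (expTau (fun _ => p₀) (B n)).toReal)
    (hunbQ : ∀ C : ℝ, ∃ n, C ≤ (expTau (fun _ => q₀) (B n)).toReal)
    (hπ : Filter.Tendsto (fun n => errProb (fun _ => p₀) (B n) (Z n) true)
      Filter.atTop (nhds 0)) :
    Filter.atTop.liminf
        (fun n => -Real.log (errProb (fun _ => q₀) (B n) (Z n) false) /
          (expTau (fun _ => p₀) (B n)).toReal) ≤ KL p₀ q₀ := by
  have hp := hP p₀ hp₀
  have hq := hQ q₀ hq₀
  have hpq := hac p₀ hp₀ q₀ hq₀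
  have hD := KL_nonneg hp hq hpq
  rw [Filter.liminf_eq]
  refine Real.sSup_le (fun a ha => ?_) hD
  by_contra! hlt
  have ha0 : 0 < a := hD.trans_lt hlt
  have hgap : 0 < a - KL p₀ q₀ := sub_pos.2 hlt
  have hε : 0 < (a - KL p₀ q₀) / (2 * a) := by positivity
  obtain ⟨N, hN⟩ := Filter.eventually_atTop.1 (Filter.Eventually.and ha (hπ.eventually_lt_const hε))
  set E : ℕ → ℝ := fun n => (expTau (fun _ => p₀) (B n)).toReal with hE
  have hE0 : ∀ n, 0 ≤ E n := fun n => ENNReal.toReal_nonneg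
  obtain ⟨n, hn⟩ := hunbP (∑ i ∈ Finset.range N, E i + 3 / (a - KL p₀ q₀))
  have hC : 0 < 3 / (a - KL p₀ q₀) := by positivity
  have hNn : N ≤ n := by
    by_contra! h
    have := Finset.single_le_sum (f := E) (fun i _ => hE0 i) (Finset.mem_range.2 h)
    change _ ≤ E n at hn
    linarith
  have hEn : 3 / (a - KL p₀ q₀) ≤ E n :=
    (le_add_of_nonneg_left (Finset.sum_nonneg fun i _ => hE0 i)).trans hn
  have hEpos : 0 < E n := hC.trans_le hEn
  obtain ⟨h1, h2⟩ := hN n hNn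
  have h1 : a * E n ≤ -Real.log (errProb (fun _ => q₀) (B n) (Z n) false) :=
    (le_div_iff₀ hEpos).1 h1
  have h3 := neg_log_errProb_mul_le hp hq hpq (Z n) (hfinP n)
    ((mul_pos ha0 hEpos).trans_le h1)
  have h4 : (a - KL p₀ q₀) / (2 * a) ≤ 1 / 2 := by
    rw [div_le_div_iff₀ (by positivity) two_pos]
    linarith
  have h5 : a * E n * (1 - (a - KL p₀ q₀) / (2 * a)) ≤ KL p₀ q₀ * E n + 1 :=
    (mul_le_mul h1 (by linarith) (by linarith) ((mul_pos ha0 hEpos).trans_le h1).le).trans h3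
  have h6 : a * E n * (1 - (a - KL p₀ q₀) / (2 * a)) =
      KL p₀ q₀ * E n + (a - KL p₀ q₀) * E n / 2 := by
    field_simp
    ring
  rw [div_le_iff₀ hgap] at hEn
  linarith
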